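/- Let N ≥ 1 and let H_1,…,H_N, G¹_1,…,G¹_N, G²_1,…,G²_N be 3N mutually independent rate-1 exponential random variables, and fix 0 ≤ ξ₁ ≤ ξ₂. Let S = {n : H_n > ξ₁, G¹_n > ξ₁, G²_n > ξ₁}. Then P( S ≠ ∅ and max_{n ∈ S} min(H_n, G²_n) < ξ₂ ) = Σ_{l=1}^{N} C(N,l) · (1 − e^{−2(ξ₂−ξ₁)})^l · e^{−3lξ₁} · (1 − e^{−3ξ₁})^{N−l}. -/

import Mathlib

open MeasureTheory ProbabilityTheory


lemma twoStage_rect {Ω : Type*} [MeasurableSpace Ω] (μ : Measure Ω) [IsProbabilityMeasure μ]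
    (N : ℕ) (X : Fin N × Fin 3 → Ω → ℝ) (hm : ∀ p, Measurable (X p)) (hI : iIndepFun X μ)
    (hX : ∀ p, μ.map (X p) = expMeasure 1) (s : Fin 3 → Set ℝ) (hs : ∀ j, MeasurableSet (s j)) :
    μ.real (⋂ n, {ω | ∀ j, X (n, j) ω ∈ s j}ᶜ) = (1 - ∏ j, (expMeasure 1).real (s j)) ^ N := by
  set R : Fin N → Set Ω := fun n => {ω | ∀ j, X (n, j) ω ∈ s j} with hR
  have hRm : ∀ n, MeasurableSet (R n) := by
    intro n
    have : R n = ⋂ j, X (n, j) ⁻¹' s j := by ext ω; simp [hR]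
    rw [this]
    exact MeasurableSet.iInter fun j => hm _ (hs j)
  have hT : ∀ T : Finset (Fin N), μ (⋂ n ∈ T, R n) = ∏ n ∈ T, ∏ j, expMeasure 1 (s j) := by
    intro T
    have h1 : (⋂ n ∈ T, R n) = ⋂ p ∈ T ×ˢ (Finset.univ : Finset (Fin 3)), X p ⁻¹' s p.2 := by
      ext ω
      simp only [hR, Set.mem_iInter, Set.mem_ofPred_eq, Finset.mem_product, Finset.mem_univ,
        and_true, Set.mem_preimage, Prod.forall]
      exact ⟨fun h a b ha => h a ha b, fun h a ha b => h a b ha⟩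
    rw [h1, hI.measure_inter_preimage_eq_mul (T ×ˢ Finset.univ) (sets := fun p => s p.2)
      (fun p _ => hs p.2), Finset.prod_product]
    refine Finset.prod_congr rfl fun n _ => Finset.prod_congr rfl fun j _ => ?_
    rw [← hX (n, j), Measure.map_apply (hm _) (hs j)]
  have hR1 : ∀ n, μ (R n) = ∏ j, expMeasure 1 (s j) := by
    intro n
    simpa using hT {n}
  have hind : iIndepSet R μ := by
    rw [iIndepSet_iff_meas_biInter hRm]
    intro T
    rw [hT T]
    exact Finset.prod_congr rfl fun n _ => (hR1 n).symm
  have hc : μ (⋂ n, (R n)ᶜ) = ∏ n, μ ((R n)ᶜ) := by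
    have h2 : iIndep (fun n => MeasurableSpace.generateFrom {R n}) μ := hind
    exact h2.meas_iInter fun n =>
      (MeasurableSpace.measurableSet_generateFrom (Set.mem_singleton _)).compl
  rw [measureReal_def, hc, ENNReal.toReal_prod]
  have : ∀ n, (μ ((R n)ᶜ)).toReal = 1 - ∏ j, (expMeasure 1).real (s j) := by
    intro n
    rw [← measureReal_def, probReal_compl_eq_one_sub (hRm n), measureReal_def, hR1,
      ENNReal.toReal_prod]
    rfl
  simp [this]

lemma expMeasure_Ioi {x : ℝ} (hx : 0 ≤ x) : (expMeasure 1).real (Set.Ioi x) = Real.exp (-x) := by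
  have := isProbabilityMeasure_expMeasure (r := 1) one_pos
  have h := cdf_expMeasure_eq one_pos x
  rw [cdf_eq_real, if_pos hx] at h
  rw [← Set.compl_Iic, probReal_compl_eq_one_sub measurableSet_Iic, h]
  simp

lemma expMeasure_Ici {x : ℝ} (hx : 0 ≤ x) : (expMeasure 1).real (Set.Ici x) = Real.exp (-x) := by
  rw [← expMeasure_Ioi hx]
  have : NullSingletonClass (expMeasure 1) := by
    unfold expMeasure gammaMeasure
    infer_instance
  exact measureReal_congr Ioi_ae_eq_Ici.symm

lemma expMeasure_inter {x y : ℝ} (hx : 0 ≤ x) (hxy : x ≤ y) :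
    (expMeasure 1).real (Set.Ioi x ∩ Set.Ici y) = Real.exp (-y) := by
  rcases hxy.eq_or_lt with rfl | h
  · rw [Set.inter_eq_left.2 Set.Ioi_subset_Ici_self, expMeasure_Ioi hx]
  · rw [Set.inter_eq_right.2 (Set.Ici_subset_Ioi.2 h), expMeasure_Ici (hx.trans hxy)]

open scoped Classical in
/-- the second outage event `O₂` of the paper: with `3N` i.i.d.
rate-1 exponential gains and thresholds `0 ≤ ξ₁ ≤ ξ₂`, the probability that the
qualified set `S` is nonempty but the relay of `S` maximizing `min (H n) (G2 n)`
still falls below `ξ₂` equals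
`∑_{l=1}^N C(N,l) (1 - e^{-2(ξ₂-ξ₁)})^l e^{-3lξ₁} (1 - e^{-3ξ₁})^{N-l}`. -/
theorem twoStage_second_outage_prob
    {Ω : Type*} [MeasurableSpace Ω] (μ : Measure Ω) [IsProbabilityMeasure μ]
    (N : ℕ) (hN : 1 ≤ N)
    (H G1 G2 : Fin N → Ω → ℝ)
    (hHm : ∀ n, Measurable (H n)) (hG1m : ∀ n, Measurable (G1 n))
    (hG2m : ∀ n, Measurable (G2 n))
    (hIndep : iIndepFun
      (fun p : Fin N × Fin 3 => ![H p.1, G1 p.1, G2 p.1] p.2) μ)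
    (hH : ∀ n, μ.map (H n) = expMeasure 1)
    (hG1 : ∀ n, μ.map (G1 n) = expMeasure 1)
    (hG2 : ∀ n, μ.map (G2 n) = expMeasure 1)
    (ξ₁ ξ₂ : ℝ) (hξ₁ : 0 ≤ ξ₁) (hξ₁₂ : ξ₁ ≤ ξ₂) :
    (μ {ω | ∃ hne : (Finset.univ.filter
          (fun n : Fin N => ξ₁ < H n ω ∧ ξ₁ < G1 n ω ∧ ξ₁ < G2 n ω)).Nonempty,
        (Finset.univ.filter
          (fun n : Fin N => ξ₁ < H n ω ∧ ξ₁ < G1 n ω ∧ ξ₁ < G2 n ω)).sup' hne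
            (fun n => min (H n ω) (G2 n ω)) < ξ₂}).toReal
      = ∑ l ∈ Finset.Icc 1 N, (N.choose l : ℝ)
          * (1 - Real.exp (-2 * (ξ₂ - ξ₁))) ^ l
          * Real.exp (-(3 * l) * ξ₁)
          * (1 - Real.exp (-3 * ξ₁)) ^ (N - l) := by
  set X : Fin N × Fin 3 → Ω → ℝ := fun p => ![H p.1, G1 p.1, G2 p.1] p.2 with hXdef
  have hm : ∀ p, Measurable (X p) := by
    rintro ⟨n, j⟩
    fin_cases j
    · exact hHm n
    · exact hG1m n
    · exact hG2m n
  have hX : ∀ p, μ.map (X p) = expMeasure 1 := by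
    rintro ⟨n, j⟩
    fin_cases j
    · exact hH n
    · exact hG1 n
    · exact hG2 n
  set sB : Fin 3 → Set ℝ := fun _ => Set.Ioi ξ₁ with hsB
  set sA : Fin 3 → Set ℝ :=
    ![Set.Ioi ξ₁ ∩ Set.Ici ξ₂, Set.Ioi ξ₁, Set.Ioi ξ₁ ∩ Set.Ici ξ₂] with hsA
  have hsBm : ∀ j, MeasurableSet (sB j) := fun _ => measurableSet_Ioi
  have hsAm : ∀ j, MeasurableSet (sA j) := by
    intro j
    fin_cases j
    · exact measurableSet_Ioi.inter measurableSet_Ici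
    · exact measurableSet_Ioi
    · exact measurableSet_Ioi.inter measurableSet_Ici
  have hA := twoStage_rect μ N X hm hIndep hX sA hsAm
  have hB := twoStage_rect μ N X hm hIndep hX sB hsBm
  have hRm : ∀ (s : Fin 3 → Set ℝ), (∀ j, MeasurableSet (s j)) →
      MeasurableSet (⋂ n, {ω | ∀ j, X (n, j) ω ∈ s j}ᶜ) := by
    intro s hs
    refine MeasurableSet.iInter fun n => MeasurableSet.compl ?_
    have : {ω | ∀ j, X (n, j) ω ∈ s j} = ⋂ j, X (n, j) ⁻¹' s j := by ext ω; simp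
    rw [this]
    exact MeasurableSet.iInter fun j => hm _ (hs j)
  set A := ⋂ n, {ω | ∀ j, X (n, j) ω ∈ sA j}ᶜ with hAdef
  set B := ⋂ n, {ω | ∀ j, X (n, j) ω ∈ sB j}ᶜ with hBdef
  have memA : ∀ ω, ω ∈ A ↔ ∀ n, (ξ₁ < H n ω ∧ ξ₁ < G1 n ω ∧ ξ₁ < G2 n ω) →
      min (H n ω) (G2 n ω) < ξ₂ := by
    intro ω
    simp only [hAdef, hXdef, hsA, Set.mem_iInter, Set.mem_compl_iff, Set.mem_ofPred_eq,
      Fin.forall_fin_succ, min_lt_iff]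
    refine forall_congr' fun n => ?_
    simp
    grind
  have memB : ∀ ω, ω ∈ B ↔ ∀ n, ¬ (ξ₁ < H n ω ∧ ξ₁ < G1 n ω ∧ ξ₁ < G2 n ω) := by
    intro ω
    simp only [hBdef, hXdef, hsB, Set.mem_iInter, Set.mem_compl_iff, Set.mem_ofPred_eq,
      Fin.forall_fin_succ]
    refine forall_congr' fun n => ?_
    simp
  have hBA : B ⊆ A := by
    intro ω hω
    rw [memA]
    intro n hn
    exact absurd hn ((memB ω).1 hω n)
  have hE : {ω | ∃ hne : (Finset.univ.filter
          (fun n : Fin N => ξ₁ < H n ω ∧ ξ₁ < G1 n ω ∧ ξ₁ < G2 n ω)).Nonempty,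
        (Finset.univ.filter
          (fun n : Fin N => ξ₁ < H n ω ∧ ξ₁ < G1 n ω ∧ ξ₁ < G2 n ω)).sup' hne
            (fun n => min (H n ω) (G2 n ω)) < ξ₂} = A \ B := by
    ext ω
    rw [Set.mem_sdiff, memA, memB, Set.mem_ofPred_eq]
    constructor
    · rintro ⟨hne, h⟩
      rw [Finset.sup'_lt_iff] at h
      refine ⟨fun n hn => h n (by simpa using hn), fun hc => ?_⟩
      obtain ⟨n, hn⟩ := hne
      exact hc n (by simpa using hn)
    · rintro ⟨h, hc⟩
      push Not at hc
      obtain ⟨n, hn⟩ := hc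
      exact ⟨Finset.filter_nonempty_iff.2 ⟨n, Finset.mem_univ n, hn⟩,
        (Finset.sup'_lt_iff _).2 fun m hmem => h m (Finset.mem_filter.1 hmem).2⟩
  rw [hE, ← measureReal_def, measureReal_sdiff hBA (hRm sB hsBm), hA, hB]
  have pA : ∏ j, (expMeasure 1).real (sA j) = Real.exp (-ξ₂) * Real.exp (-ξ₁) * Real.exp (-ξ₂) := by
    rw [Fin.prod_univ_three]
    change (expMeasure 1).real (Set.Ioi ξ₁ ∩ Set.Ici ξ₂) * (expMeasure 1).real (Set.Ioi ξ₁) *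
      (expMeasure 1).real (Set.Ioi ξ₁ ∩ Set.Ici ξ₂) = _
    rw [expMeasure_inter hξ₁ hξ₁₂, expMeasure_Ioi hξ₁]
  have pB : ∏ j, (expMeasure 1).real (sB j) = Real.exp (-3 * ξ₁) := by
    simp only [hsB, Fin.prod_univ_three, expMeasure_Ioi hξ₁, ← Real.exp_add]
    ring_nf
  have hsum : 1 - ∏ j, (expMeasure 1).real (sA j) =
      (1 - Real.exp (-2 * (ξ₂ - ξ₁))) * Real.exp (-3 * ξ₁) + (1 - Real.exp (-3 * ξ₁)) := by
    rw [pA]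
    have : Real.exp (-2 * (ξ₂ - ξ₁)) * Real.exp (-3 * ξ₁) =
        Real.exp (-ξ₂) * Real.exp (-ξ₁) * Real.exp (-ξ₂) := by
      simp only [← Real.exp_add]
      ring_nf
    rw [← this]
    ring
  rw [hsum, pB, add_pow, Finset.range_eq_Ico, Finset.sum_eq_sum_Ico_succ_bot (by omega)]
  simp only [pow_zero, one_mul, Nat.sub_zero, Nat.choose_zero_right, Nat.cast_one, mul_one,
    add_sub_cancel_left]
  refine Finset.sum_congr (by ext; simp) fun l _ => ?_
  rw [mul_pow, ← Real.exp_nat_mul]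
  have : (l : ℝ) * (-3 * ξ₁) = -(3 * l) * ξ₁ := by ring
  rw [this]
  ring
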